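/- Let σ₀ ⊆ ℝ^n be a pointed polyhedral cone, let τ be a face of σ₀, let w ∈ ℝ^n, and let h_{τ,w} ∈ N_ℝ(σ₀) be defined by h_{τ,w}(u) = ⟨u, w⟩ if ⟨u, x⟩ = 0 for all x ∈ τ, and h_{τ,w}(u) = -∞ otherwise (for u ∈ σ₀^∨). Let P ⊆ ℝ^n be a nonempty polyhedron. Then h_{τ,w} lies in the closure of ι(P) in N_ℝ(σ₀) if and only if relint(τ) ∩ ρ(P) ≠ ∅ and w ∈ P + span(τ), where relint denotes relative interior and span(τ) is the linear span of τ. -/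

import Mathlib

open Set Pointwise

/-- A polyhedron: a finite intersection of closed halfspaces `{v : ⟨uᵢ, v⟩ ≤ cᵢ}`. -/
def IsPolyhedron {V : Type*} [AddCommGroup V] [Module ℝ V] (P : Set V) : Prop :=
  ∃ (m : ℕ) (u : Fin m → (V →ₗ[ℝ] ℝ)) (c : Fin m → ℝ),
    P = ⋂ i, {v : V | u i v ≤ c i}

/-- The recession cone `ρ(P) = {w : v + w ∈ P for all v ∈ P}`. -/
def recCone {V : Type*} [AddCommGroup V] [Module ℝ V] (P : Set V) : Set V :=
  {w : V | ∀ v ∈ P, v + w ∈ P}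

/-- A polyhedral cone: a finite intersection of halfspaces `{v : ⟨uᵢ, v⟩ ≤ 0}`. -/
def IsPolyCone {V : Type*} [AddCommGroup V] [Module ℝ V] (σ : Set V) : Prop :=
  ∃ (m : ℕ) (u : Fin m → (V →ₗ[ℝ] ℝ)), σ = ⋂ i, {v : V | u i v ≤ 0}

/-- A set is pointed if it contains no nonzero linear subspace. -/
def IsPointedSet {V : Type*} [AddCommGroup V] [Module ℝ V] (σ : Set V) : Prop :=
  ∀ W : Submodule ℝ V, (W : Set V) ⊆ σ → W = ⊥

/-- `F` is a face of the polyhedral cone `σ`. -/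
def IsFaceOfCone {V : Type*} [AddCommGroup V] [Module ℝ V] (σ F : Set V) : Prop :=
  ∃ u : V →ₗ[ℝ] ℝ, (∀ x ∈ σ, u x ≤ 0) ∧ F = {x ∈ σ | u x = 0}

/-- The dual cone `σ^∨ = {u : ⟨u, v⟩ ≤ 0 for all v ∈ σ}` inside the dual space. -/
def dualCone {n : ℕ} (σ : Set (Fin n → ℝ)) : Set ((Fin n → ℝ) →ₗ[ℝ] ℝ) :=
  {u | ∀ v ∈ σ, u v ≤ 0}

/-- The canonical map `ι : ℝⁿ → (σ₀^∨ → ℝ ∪ {-∞})`, `ι(v)(u) = ⟨u, v⟩`; the target carries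
the topology of pointwise convergence. -/
def iotaTrop {n : ℕ} (σ₀ : Set (Fin n → ℝ)) (v : Fin n → ℝ) :
    ↥(dualCone σ₀) → EReal :=
  fun u => ((u.1 v : ℝ) : EReal)

/-- The extended tropicalization `N_ℝ(σ₀)`: the set of monoid homomorphisms
`h : σ₀^∨ → ℝ ∪ {-∞}` with `h(0) = 0`, `h(u + u') = h(u) + h(u')` and `h(r • u) = r·h(u)`
for `r > 0`, realized as the `EReal`-valued functions on `σ₀^∨` never taking the value `+∞`. -/
def NRext {n : ℕ} (σ₀ : Set (Fin n → ℝ)) : Set (↥(dualCone σ₀) → EReal) :=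
  {h | (∀ u, h u ≠ ⊤) ∧
       (∀ u : ↥(dualCone σ₀), (u : (Fin n → ℝ) →ₗ[ℝ] ℝ) = 0 → h u = 0) ∧
       (∀ u u' s : ↥(dualCone σ₀),
         (s : (Fin n → ℝ) →ₗ[ℝ] ℝ) = (u : (Fin n → ℝ) →ₗ[ℝ] ℝ) + (u' : (Fin n → ℝ) →ₗ[ℝ] ℝ) →
           h s = h u + h u') ∧
       (∀ r : ℝ, 0 < r → ∀ u s : ↥(dualCone σ₀),
         (s : (Fin n → ℝ) →ₗ[ℝ] ℝ) = r • (u : (Fin n → ℝ) →ₗ[ℝ] ℝ) →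
           h s = (r : EReal) * h u)}

/-- One-variable Fourier–Motzkin step: finitely many affine bounds on a real number are
simultaneously satisfiable if all lower bounds are below all upper bounds. -/
lemma exists_forall_mul_le {ι : Type*} [Finite ι] (α β : ι → ℝ)
    (h0 : ∀ i, α i = 0 → 0 ≤ β i)
    (hpq : ∀ p q, 0 < α p → α q < 0 → 0 ≤ α p * β q - α q * β p) :
    ∃ t : ℝ, ∀ i, α i * t ≤ β i := by
  set L : Set ℝ := (fun q => β q / α q) '' {q | α q < 0} with hL
  set U : Set ℝ := (fun p => β p / α p) '' {p | 0 < α p} with hU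
  have hLU : ∀ x ∈ L, ∀ y ∈ U, x ≤ y := by
    rintro _ ⟨q, hq, rfl⟩ _ ⟨p, hp, rfl⟩
    simp only [mem_ofPred_eq] at hq hp
    have := hpq p q hp hq
    rw [div_le_iff_of_neg hq, div_mul_eq_mul_div, div_le_iff₀ hp]
    linarith
  have hLf : L.Finite := (Set.toFinite _).image _
  have hUf : U.Finite := (Set.toFinite _).image _
  have key : ∃ t, t ∈ upperBounds L ∧ t ∈ lowerBounds U := by
    rcases L.eq_empty_or_nonempty with hLe | hLn
    · obtain ⟨t, ht⟩ := hUf.bddBelow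
      exact ⟨t, by simp [hLe], ht⟩
    rcases U.eq_empty_or_nonempty with hUe | hUn
    · obtain ⟨t, ht⟩ := hLf.bddAbove
      exact ⟨t, ht, by simp [hUe]⟩
    exact exists_between_of_forall_le hLn hUn hLU
  obtain ⟨t, htL, htU⟩ := key
  refine ⟨t, fun i => ?_⟩
  rcases lt_trichotomy (α i) 0 with hi | hi | hi
  · have := htL ⟨i, hi, rfl⟩
    rw [div_le_iff_of_neg hi] at this
    linarith
  · simpa [hi] using h0 i hi
  · have := htU ⟨i, hi, rfl⟩
    rw [le_div_iff₀ hi] at this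
    linarith

/-- A finite system of linear inequalities that is solvable up to every positive error
is solvable. -/
lemma exists_dotProduct_le_of_approx (n : ℕ) :
    ∀ {ι : Type} [Finite ι] (a : ι → Fin n → ℝ) (d : ι → ℝ),
      (∀ ε > 0, ∃ x : Fin n → ℝ, ∀ i, a i ⬝ᵥ x ≤ d i + ε) →
      ∃ x : Fin n → ℝ, ∀ i, a i ⬝ᵥ x ≤ d i := by
  induction n with
  | zero =>
    intro ι _ a d h
    refine ⟨0, fun i => le_of_forall_pos_le_add fun ε hε => ?_⟩
    obtain ⟨x, hx⟩ := h ε hε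
    rw [Subsingleton.elim 0 x]
    exact hx i
  | succ n ih =>
    intro ι _ a d h
    have hsplit : ∀ i (x : Fin (n + 1) → ℝ),
        a i ⬝ᵥ x = a i 0 * x 0 + Fin.tail (a i) ⬝ᵥ Fin.tail x := fun i x => by
      simp [dotProduct, Fin.sum_univ_succ, Fin.tail]
    obtain ⟨K, hK⟩ := (Set.finite_range fun i => |a i 0|).bddAbove
    replace hK : ∀ i, |a i 0| ≤ K := fun i => hK ⟨i, rfl⟩
    obtain ⟨y, hy⟩ := ih (ι := {i // a i 0 = 0} ⊕ ({i // 0 < a i 0} × {i // a i 0 < 0}))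
      (Sum.elim (fun i => Fin.tail (a i))
        fun r => a r.1 0 • Fin.tail (a r.2) - a r.2 0 • Fin.tail (a r.1))
      (Sum.elim (fun i => d i) fun r => a r.1 0 * d r.2 - a r.2 0 * d r.1) (by
        intro ε hε
        obtain ⟨x, hx⟩ := h (ε / (1 + 2 * |K|)) (by positivity)
        set δ := ε / (1 + 2 * |K|) with hδ
        have hδ0 : 0 < δ := by positivity
        have hδε : δ * (1 + 2 * |K|) = ε := by
          rw [hδ]; field_simp
        have hKδ : 0 ≤ δ * |K| := by positivity
        refine ⟨Fin.tail x, ?_⟩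
        rintro (⟨i, hi⟩ | ⟨⟨p, hp⟩, ⟨q, hq⟩⟩)
        · have := hx i
          rw [hsplit, hi] at this
          simp only [Sum.elim_inl]
          linarith
        · have h1 := hx p
          have h2 := hx q
          rw [hsplit] at h1 h2
          simp only [Sum.elim_inr, sub_dotProduct, smul_dotProduct, smul_eq_mul]
          have h3 := mul_le_mul_of_nonneg_left h2 hp.le
          have h4 := mul_le_mul_of_nonpos_left h1 hq.le
          have hp' : a p 0 ≤ |K| := (le_abs_self _).trans ((hK p).trans (le_abs_self K))
          have hq' : -a q 0 ≤ |K| := (neg_le_abs _).trans ((hK q).trans (le_abs_self K))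
          have h5 := mul_le_mul_of_nonneg_right hp' hδ0.le
          have h6 := mul_le_mul_of_nonneg_right hq' hδ0.le
          linarith)
    obtain ⟨t, ht⟩ := exists_forall_mul_le (fun i => a i 0)
      (fun i => d i - Fin.tail (a i) ⬝ᵥ y)
      (fun i hi => by simpa using hy (Sum.inl ⟨i, hi⟩))
      (fun p q hp hq => by
        have := hy (Sum.inr (⟨p, hp⟩, ⟨q, hq⟩))
        simp only [Sum.elim_inr, sub_dotProduct, smul_dotProduct, smul_eq_mul] at this
        linarith)
    refine ⟨Fin.cons t y, fun i => ?_⟩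
    rw [hsplit, Fin.cons_zero, Fin.tail_cons]
    linarith [ht i]

/-- `exists_dotProduct_le_of_approx` phrased for linear functionals. -/
lemma exists_linearMap_le_of_approx {n : ℕ} {ι : Type} [Finite ι]
    (f : ι → (Fin n → ℝ) →ₗ[ℝ] ℝ) (d : ι → ℝ)
    (h : ∀ ε > 0, ∃ x : Fin n → ℝ, ∀ i, f i x ≤ d i + ε) :
    ∃ x : Fin n → ℝ, ∀ i, f i x ≤ d i := by
  have hf : ∀ i x, f i x = (fun j => f i (Pi.single j 1)) ⬝ᵥ x := fun i x => by
    rw [LinearMap.pi_apply_eq_sum_univ (f i) x]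
    simp only [dotProduct, smul_eq_mul]
    refine Finset.sum_congr rfl fun j _ => ?_
    rw [mul_comm]
    congr 2
    ext k
    simp [Pi.single_apply, eq_comm]
  obtain ⟨x, hx⟩ := exists_dotProduct_le_of_approx n (fun i j => f i (Pi.single j 1)) d
    fun ε hε => (h ε hε).imp fun x hx i => (hf i x).symm.trans_le (hx i)
  exact ⟨x, fun i => (hf i x).trans_le (hx i)⟩

/-- A segment ending in the relative interior of a set can be prolonged inside the set. -/
lemma exists_prolong_of_mem_intrinsicInterior {n : ℕ} {s : Set (Fin n → ℝ)} {x y : Fin n → ℝ}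
    (hx : x ∈ intrinsicInterior ℝ s) (hy : y ∈ s) :
    ∃ ε : ℝ, 0 < ε ∧ x + ε • (x - y) ∈ s := by
  obtain ⟨x', hx', rfl⟩ := mem_intrinsicInterior.1 hx
  have hmem : ∀ ε : ℝ, (x' : Fin n → ℝ) + ε • ((x' : Fin n → ℝ) - y) ∈ affineSpan ℝ s := by
    intro ε
    have := AffineSubspace.vadd_mem_of_mem_direction (s := affineSpan ℝ s)
      (Submodule.smul_mem _ ε
        (AffineSubspace.vsub_mem_direction x'.2 (subset_affineSpan ℝ s hy))) x'.2
    simpa [add_comm] using this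
  let g : ℝ → affineSpan ℝ s := fun ε => ⟨_, hmem ε⟩
  have hg : Continuous g := by
    refine Continuous.subtype_mk ?_ _
    fun_prop
  have hg0 : g 0 = x' := Subtype.ext (by simp [g])
  have hev : ∀ᶠ ε in nhds (0 : ℝ), g ε ∈ interior ((↑) ⁻¹' s : Set (affineSpan ℝ s)) :=
    hg.continuousAt.eventually_mem (isOpen_interior.mem_nhds (by rwa [hg0]))
  obtain ⟨ε, hε, hpos⟩ := ((hev.filter_mono nhdsWithin_le_nhds).and
    (self_mem_nhdsWithin : ∀ᶠ ε in nhdsWithin (0 : ℝ) (Ioi 0), ε ∈ Ioi (0 : ℝ))).exists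
  have hgs : g ε ∈ ((↑) ⁻¹' s : Set (affineSpan ℝ s)) := interior_subset hε
  exact ⟨ε, hpos, hgs⟩

/-- A functional that is nonpositive on a set and not identically zero there is negative
on the relative interior. -/
lemma neg_of_mem_intrinsicInterior {n : ℕ} {s : Set (Fin n → ℝ)} {x : Fin n → ℝ}
    (hx : x ∈ intrinsicInterior ℝ s) (u : (Fin n → ℝ) →ₗ[ℝ] ℝ) (hu : ∀ y ∈ s, u y ≤ 0)
    (hne : ¬ ∀ y ∈ s, u y = 0) : u x < 0 := by
  push Not at hne
  obtain ⟨y, hy, hy0⟩ := hne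
  have hyneg : u y < 0 := lt_of_le_of_ne (hu y hy) hy0
  obtain ⟨ε, hε, hmem⟩ := exists_prolong_of_mem_intrinsicInterior hx hy
  have := hu _ hmem
  simp only [map_add, map_smul, map_sub, smul_eq_mul] at this
  by_contra! hcon
  nlinarith [mul_pos hε (sub_pos.2 (hyneg.trans_le hcon))]

section Face

variable {n m : ℕ} {σ τ : Set (Fin n → ℝ)} {a : Fin m → (Fin n → ℝ) →ₗ[ℝ] ℝ}
  {u₀ : (Fin n → ℝ) →ₗ[ℝ] ℝ}

/-- The span of a face is cut out by the defining functionals that vanish on the face. -/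
lemma mem_span_face (hσ : σ = ⋂ i, {v | a i v ≤ 0}) (hu₀ : ∀ x ∈ σ, u₀ x ≤ 0)
    (hτ : τ = {x ∈ σ | u₀ x = 0}) {z : Fin n → ℝ}
    (hz : ∀ j, (∀ y ∈ τ, a j y = 0) → a j z = 0) : z ∈ Submodule.span ℝ τ := by
  have hmem : ∀ x, x ∈ σ ↔ ∀ j, a j x ≤ 0 := by simp [hσ]
  have hmemτ : ∀ x, x ∈ τ ↔ x ∈ σ ∧ u₀ x = 0 := by simp [hτ]
  have hconv : Convex ℝ τ := by
    intro x hx y hy r s hr hs _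
    rw [hmemτ, hmem] at *
    refine ⟨fun j => ?_, by simp [hx.2, hy.2]⟩
    simp only [map_add, map_smul, smul_eq_mul]
    nlinarith [mul_nonneg hr (neg_nonneg.2 (hx.1 j)), mul_nonneg hs (neg_nonneg.2 (hy.1 j))]
  have h0 : (0 : Fin n → ℝ) ∈ τ := by simp [hmemτ, hmem]
  obtain ⟨x, hx⟩ := Set.Nonempty.intrinsicInterior hconv ⟨0, h0⟩
  have hxτ := intrinsicInterior_subset hx
  have hxσ := (hmem x).1 ((hmemτ x).1 hxτ).1
  have hev : ∀ᶠ ε in nhds (0 : ℝ), ∀ j, a j (x + ε • z) ≤ 0 ∧ a j (x - ε • z) ≤ 0 := by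
    refine Filter.eventually_all.2 fun j => ?_
    by_cases hj : ∀ y ∈ τ, a j y = 0
    · exact Filter.Eventually.of_forall fun ε => by simp [hz j hj, hxσ j]
    · have hneg : a j x < 0 := neg_of_mem_intrinsicInterior hx (a j)
        (fun y hy => (hmem y).1 ((hmemτ y).1 hy).1 j) hj
      have h1 : ContinuousAt (fun ε : ℝ => a j x + ε * a j z) 0 := by fun_prop
      have h2 : ContinuousAt (fun ε : ℝ => a j x - ε * a j z) 0 := by fun_prop
      filter_upwards [h1.eventually_lt_const (by simpa using hneg),
        h2.eventually_lt_const (by simpa using hneg)] with ε he1 he2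
      simp only [map_add, map_sub, map_smul, smul_eq_mul]
      exact ⟨he1.le, he2.le⟩
  obtain ⟨ε, hε, hpos⟩ := ((hev.filter_mono nhdsWithin_le_nhds).and
    (self_mem_nhdsWithin : ∀ᶠ ε in nhdsWithin (0 : ℝ) (Ioi 0), ε ∈ Ioi (0 : ℝ))).exists
  replace hpos : 0 < ε := hpos
  have hplus : x + ε • z ∈ σ := (hmem _).2 fun j => (hε j).1
  have hminus : x - ε • z ∈ σ := (hmem _).2 fun j => (hε j).2
  have hux : u₀ x = 0 := ((hmemτ x).1 hxτ).2
  have h1 := hu₀ _ hplus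
  have h2 := hu₀ _ hminus
  simp only [map_add, map_sub, map_smul, smul_eq_mul, hux] at h1 h2
  have hτz : x + ε • z ∈ τ := by
    rw [hmemτ]
    refine ⟨hplus, ?_⟩
    simp only [map_add, map_smul, smul_eq_mul, hux]
    linarith
  have : z = ε⁻¹ • ((x + ε • z) - x) := by
    rw [add_sub_cancel_left, inv_smul_smul₀ hpos.ne']
  rw [this]
  exact Submodule.smul_mem _ _
    (Submodule.sub_mem _ (Submodule.subset_span hτz) (Submodule.subset_span hxτ))

/-- A point lies in the relative interior of a face as soon as the defining functionals are zero
or negative on it according to whether they vanish on the face. -/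
lemma mem_intrinsicInterior_face (hσ : σ = ⋂ i, {v | a i v ≤ 0}) (hu₀ : ∀ x ∈ σ, u₀ x ≤ 0)
    (hτ : τ = {x ∈ σ | u₀ x = 0}) {x : Fin n → ℝ}
    (hx0 : ∀ j, (∀ y ∈ τ, a j y = 0) → a j x = 0)
    (hxneg : ∀ j, (¬ ∀ y ∈ τ, a j y = 0) → a j x < 0) : x ∈ intrinsicInterior ℝ τ := by
  have hvanish : ∀ v : (Fin n → ℝ) →ₗ[ℝ] ℝ, (∀ y ∈ τ, v y = 0) →
      ∀ z ∈ Submodule.span ℝ τ, v z = 0 := fun v hv z hz =>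
    (Submodule.span_le.2 hv : Submodule.span ℝ τ ≤ LinearMap.ker v) hz
  have hu₀τ : ∀ y ∈ τ, u₀ y = 0 := by
    rw [hτ]; exact fun y hy => hy.2
  have hsub : ∀ z ∈ Submodule.span ℝ τ, (∀ j, (¬ ∀ y ∈ τ, a j y = 0) → a j z < 0) → z ∈ τ := by
    intro z hz hneg
    have h1 : z ∈ σ := by
      rw [hσ]
      refine mem_iInter.2 fun j => ?_
      by_cases hj : ∀ y ∈ τ, a j y = 0
      · exact (hvanish _ hj z hz).le
      · exact (hneg j hj).le
    rw [hτ]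
    exact ⟨h1, hvanish _ hu₀τ z hz⟩
  have hxτ : x ∈ τ := hsub x (mem_span_face hσ hu₀ hτ hx0) hxneg
  refine mem_intrinsicInterior.2 ⟨⟨x, subset_affineSpan ℝ τ hxτ⟩, ?_, rfl⟩
  refine mem_interior.2
    ⟨{z | ∀ j, (¬ ∀ y ∈ τ, a j y = 0) → a j (z : Fin n → ℝ) < 0}, ?_, ?_, hxneg⟩
  · intro z hz
    exact hsub z (affineSpan_subset_span z.2) hz
  · simp only [ofPred_forall]
    refine isOpen_iInter_of_finite fun j => isOpen_iInter_of_finite fun _ => ?_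
    exact isOpen_lt
      ((LinearMap.continuous_of_finiteDimensional (a j)).comp continuous_subtype_val)
      continuous_const

end Face

/-- Points of `P` approximating a limit point of `iotaTrop σ₀ '' P`, measured on finitely many
elements of the dual cone. -/
lemma exists_approx_of_mem_closure_iota {n m : ℕ} {σ₀ P : Set (Fin n → ℝ)}
    {h : ↥(dualCone σ₀) → EReal} (hh : h ∈ closure (iotaTrop σ₀ '' P))
    (a : Fin m → ↥(dualCone σ₀)) {N ε : ℝ} (hε : 0 < ε) :
    ∃ p ∈ P, ∀ j, (h (a j) = ⊥ → (a j).1 p < N) ∧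
      ∀ r : ℝ, h (a j) = (r : EReal) → (a j).1 p < r + ε ∧ r - ε < (a j).1 p := by
  let O : Fin m → Set EReal := fun j =>
    {y | (h (a j) = ⊥ → y < (N : EReal)) ∧
      ∀ r : ℝ, h (a j) = (r : EReal) → y < ((r + ε : ℝ) : EReal) ∧ ((r - ε : ℝ) : EReal) < y}
  have hO : ∀ j, IsOpen (O j) := by
    intro j
    induction hj : h (a j) with
    | bot =>
      have : O j = Iio (N : EReal) := by ext y; simp [O, hj]
      rw [this]; exact isOpen_Iio
    | top =>
      have : O j = univ := by ext y; simp [O, hj]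
      rw [this]; exact isOpen_univ
    | coe r =>
      have : O j = Iio ((r + ε : ℝ) : EReal) ∩ Ioi ((r - ε : ℝ) : EReal) := by
        ext y
        simp only [O, hj, EReal.coe_ne_bot, false_imp_iff, true_and, EReal.coe_eq_coe_iff,
          mem_ofPred_eq, forall_eq']
        rfl
      rw [this]; exact isOpen_Iio.inter isOpen_Ioi
  have hopen : IsOpen (⋂ j, (fun g : ↥(dualCone σ₀) → EReal => g (a j)) ⁻¹' O j) :=
    isOpen_iInter_of_finite fun j => (hO j).preimage (continuous_apply _)
  obtain ⟨_, hg, p, hp, rfl⟩ := mem_closure_iff.1 hh _ hopen (by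
    refine mem_iInter.2 fun j => ⟨fun hj => ?_, fun r hr => ?_⟩
    · simp only [hj]; exact EReal.bot_lt_coe N
    · simp only [hr, EReal.coe_lt_coe_iff]
      constructor <;> linarith)
  refine ⟨p, hp, fun j => ?_⟩
  obtain ⟨h1, h2⟩ := mem_iInter.1 hg j
  exact ⟨fun hj => EReal.coe_lt_coe_iff.1 (h1 hj),
    fun r hr => ⟨EReal.coe_lt_coe_iff.1 (h2 r hr).1, EReal.coe_lt_coe_iff.1 (h2 r hr).2⟩⟩

open scoped Classical in
/-- Let `σ₀ ⊆ ℝⁿ` be a pointed polyhedral cone, `τ` a face of `σ₀`, `w ∈ ℝⁿ`, and let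
`h_{τ,w}(u) = ⟨u, w⟩` if `u` vanishes on `τ`, and `-∞` otherwise.  For a nonempty polyhedron
`P ⊆ ℝⁿ`, the point `h_{τ,w}` lies in the closure of `ι(P)` in `N_ℝ(σ₀)` iff
`relint(τ) ∩ ρ(P) ≠ ∅` and `w ∈ P + span(τ)`. -/
theorem mem_closure_iota_iff {n : ℕ} (σ₀ : Set (Fin n → ℝ)) (hσ₀ : IsPolyCone σ₀)
    (hpt : IsPointedSet σ₀) (τ : Set (Fin n → ℝ)) (hτ : IsFaceOfCone σ₀ τ)
    (w : Fin n → ℝ) (P : Set (Fin n → ℝ)) (hP : IsPolyhedron P) (hne : P.Nonempty) :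
    (fun u : ↥(dualCone σ₀) =>
        if ∀ x ∈ τ, (u : (Fin n → ℝ) →ₗ[ℝ] ℝ) x = 0
        then (((u : (Fin n → ℝ) →ₗ[ℝ] ℝ) w : ℝ) : EReal) else (⊥ : EReal))
      ∈ closure (iotaTrop σ₀ '' P) ↔
    (intrinsicInterior ℝ τ ∩ recCone P).Nonempty ∧
      w ∈ P + (Submodule.span ℝ τ : Set (Fin n → ℝ)) := by
  obtain ⟨m, a, hσ⟩ := hσ₀
  obtain ⟨u₀, hu₀, hτ⟩ := hτ
  obtain ⟨k, b, c, hPc⟩ := hP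
  have hmemP : ∀ v, v ∈ P ↔ ∀ i, b i v ≤ c i := by simp [hPc]
  constructor
  · intro hcl
    have ha : ∀ j, a j ∈ dualCone σ₀ := by
      intro j v hv
      rw [hσ] at hv
      exact mem_iInter.1 hv j
    have happ : ∀ N ε : ℝ, 0 < ε → ∃ p ∈ P, ∀ j,
        ((¬ ∀ y ∈ τ, a j y = 0) → a j p < N) ∧
        ((∀ y ∈ τ, a j y = 0) → a j p < a j w + ε ∧ a j w - ε < a j p) := by
      intro N ε hε
      obtain ⟨p, hp, hpj⟩ := exists_approx_of_mem_closure_iota (m := m) hcl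
        (fun j => ⟨a j, ha j⟩) (N := N) hε
      exact ⟨p, hp, fun j => ⟨fun hj => (hpj j).1 (if_neg hj),
        fun hj => (hpj j).2 _ (if_pos hj)⟩⟩
    constructor
    · obtain ⟨x, hx⟩ := exists_linearMap_le_of_approx (ι := Fin k ⊕ (Fin m ⊕ Fin m))
        (Sum.elim b (Sum.elim a fun j => if ∀ y ∈ τ, a j y = 0 then -a j else 0))
        (Sum.elim (fun _ => 0)
          (Sum.elim (fun j => if ∀ y ∈ τ, a j y = 0 then 0 else -1) fun _ => 0)) (by
          intro ε hε
          obtain ⟨C, hC⟩ := (Set.finite_range c).bddAbove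
          obtain ⟨D, hD⟩ := (Set.finite_range fun j => |a j w|).bddAbove
          replace hC : ∀ i, c i ≤ C := fun i => hC ⟨i, rfl⟩
          replace hD : ∀ j, |a j w| ≤ D := fun j => hD ⟨j, rfl⟩
          set M : ℝ := (|C| + |D| + 1) / ε with hM
          have hM0 : 0 < M := by positivity
          have hMε : M * ε = |C| + |D| + 1 := by rw [hM]; field_simp
          obtain ⟨p, hp, hpj⟩ := happ (-M) 1 one_pos
          refine ⟨M⁻¹ • p, ?_⟩
          have hscale : ∀ (v : (Fin n → ℝ) →ₗ[ℝ] ℝ) (e : ℝ), v p ≤ M * e → v (M⁻¹ • p) ≤ e := by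
            intro v e hv
            rw [map_smul, smul_eq_mul, inv_mul_le_iff₀ hM0]
            exact hv
          rintro (i | j | j)
          · refine hscale _ _ ?_
            have := (hmemP p).1 hp i
            simp only [Sum.elim_inl, zero_add]
            linarith [hC i, le_abs_self C, abs_nonneg D]
          · refine hscale _ _ ?_
            have h1 := hpj j
            simp only [Sum.elim_inr, Sum.elim_inl]
            split_ifs with hj
            · rw [zero_add]
              linarith [(h1.2 hj).1, le_abs_self (a j w), hD j, le_abs_self D, abs_nonneg C]
            · linarith [h1.1 hj, mul_pos hM0 hε]
          · refine hscale _ _ ?_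
            have h1 := hpj j
            simp only [Sum.elim_inr, zero_add]
            split_ifs with hj
            · rw [LinearMap.neg_apply]
              linarith [(h1.2 hj).2, neg_le_abs (a j w), hD j, le_abs_self D, abs_nonneg C]
            · simp only [LinearMap.zero_apply]
              positivity)
      refine ⟨x, mem_intrinsicInterior_face hσ hu₀ hτ (fun j hj => ?_) (fun j hj => ?_), ?_⟩
      · have h1 := hx (Sum.inr (Sum.inl j))
        have h2 := hx (Sum.inr (Sum.inr j))
        simp only [Sum.elim_inr, Sum.elim_inl, if_pos hj, LinearMap.neg_apply] at h1 h2
        linarith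
      · have h1 := hx (Sum.inr (Sum.inl j))
        simp only [Sum.elim_inr, Sum.elim_inl, if_neg hj] at h1
        linarith
      · intro v hv
        rw [hmemP] at hv ⊢
        intro i
        have h1 := hx (Sum.inl i)
        simp only [Sum.elim_inl] at h1
        rw [map_add]
        linarith [hv i]
    · obtain ⟨p, hp⟩ := exists_linearMap_le_of_approx (ι := Fin k ⊕ (Fin m ⊕ Fin m))
        (Sum.elim b (Sum.elim (fun j => if ∀ y ∈ τ, a j y = 0 then a j else 0)
          fun j => if ∀ y ∈ τ, a j y = 0 then -a j else 0))
        (Sum.elim c (Sum.elim (fun j => if ∀ y ∈ τ, a j y = 0 then a j w else 0)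
          fun j => if ∀ y ∈ τ, a j y = 0 then -a j w else 0)) (by
          intro ε hε
          obtain ⟨p, hp, hpj⟩ := happ 0 ε hε
          refine ⟨p, ?_⟩
          rintro (i | j | j)
          · simp only [Sum.elim_inl]
            linarith [(hmemP p).1 hp i]
          · have h1 := hpj j
            simp only [Sum.elim_inr, Sum.elim_inl]
            split_ifs with hj
            · exact (h1.2 hj).1.le
            · simpa using hε.le
          · have h1 := hpj j
            simp only [Sum.elim_inr]
            split_ifs with hj
            · rw [LinearMap.neg_apply]
              linarith [(h1.2 hj).2]
            · simpa using hε.le)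
      refine Set.mem_add.2 ⟨p, (hmemP p).2 fun i => hp (Sum.inl i), w - p,
        mem_span_face hσ hu₀ hτ fun j hj => ?_, add_sub_cancel p w⟩
      have h1 := hp (Sum.inr (Sum.inl j))
      have h2 := hp (Sum.inr (Sum.inr j))
      simp only [Sum.elim_inr, Sum.elim_inl, if_pos hj, LinearMap.neg_apply] at h1 h2
      rw [map_sub]
      linarith
  · rintro ⟨⟨x, hxτ, hxP⟩, hw⟩
    obtain ⟨p, hp, s, hs, rfl⟩ := Set.mem_add.1 hw
    have hray : ∀ N : ℕ, p + (N : ℝ) • x ∈ P := by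
      intro N
      induction N with
      | zero => simpa using hp
      | succ N ih =>
        have := hxP _ ih
        rw [Nat.cast_succ, add_smul, one_smul, ← add_assoc]
        exact this
    refine mem_closure_of_tendsto (b := Filter.atTop)
      (f := fun N : ℕ => iotaTrop σ₀ (p + (N : ℝ) • x)) ?_
      (Filter.Eventually.of_forall fun N => mem_image_of_mem _ (hray N))
    refine tendsto_pi_nhds.2 fun u => ?_
    simp only [iotaTrop, map_add, map_smul, smul_eq_mul]
    split_ifs with hu
    · have hus : u.1 s = 0 :=
        (Submodule.span_le.2 hu : Submodule.span ℝ τ ≤ LinearMap.ker u.1) hs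
      simp [hu x (intrinsicInterior_subset hxτ), hus]
    · have hneg : u.1 x < 0 := neg_of_mem_intrinsicInterior hxτ u.1
        (fun y hy => u.2 y (by rw [hτ] at hy; exact hy.1)) hu
      refine EReal.tendsto_coe_nhds_bot_iff.2 ?_
      exact Filter.tendsto_atBot_add_const_left _ _
        (tendsto_natCast_atTop_atTop.atTop_mul_const_of_neg hneg)
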